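/- Let Ȳ_1, …, Ȳ_N be jointly Gaussian random vectors, each Ȳ_α standard Gaussian in R^{d_α}, with cross-correlation matrices R^{α,β} = (E[Y_{α,i} Y_{β,j}])_{i,j} for α ≠ β. Let s*_{α,β} be the largest singular value of R^{α,β} (with s*_{α,α} = 0) and σ_0 the largest eigenvalue of the symmetric matrix S* = (s*_{α,β}). Fix n ≥ 1, and for each α let P_n(Ȳ_α) = Σ_{|k̄| = n} a_{α,k̄} :Ȳ_α^{k̄}:/√(k̄!) be a degree-n Wick polynomial with real coefficients. Then |‖Σ_{α=1}^N P_n(Ȳ_α)‖_2^2 − Σ_{α=1}^N ‖P_n(Ȳ_α)‖_2^2| ≤ σ_0 · Σ_{α=1}^N ‖P_n(Ȳ_α)‖_2^2; in particular (1 − σ_0) Σ_α ‖P_n(Ȳ_α)‖_2^2 ≤ ‖Σ_α P_n(Ȳ_α)‖_2^2 ≤ (1 + σ_0) Σ_α ‖P_n(Ȳ_α)‖_2^2. -/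

import Mathlib

open MeasureTheory ProbabilityTheory
open scoped NNReal

/-- The `n`-th probabilists' Hermite polynomial, evaluated at a real `x`. -/
noncomputable def He (n : ℕ) (x : ℝ) : ℝ := Polynomial.aeval x (Polynomial.hermite n)

/-- A family of random vectors `Y α : Ω → Fin (d α) → ℝ` is jointly centered Gaussian if every
linear combination of all their coordinates has a centered Gaussian law. -/
def IsJointGaussianFamily {Ω : Type*} [MeasurableSpace Ω] (μ : Measure Ω) {N : ℕ}
    {d : Fin N → ℕ} (Y : (α : Fin N) → Ω → Fin (d α) → ℝ) : Prop :=
  ∀ c : (α : Fin N) → Fin (d α) → ℝ, ∃ v : ℝ≥0,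
    Measure.map (fun ω => ∑ α, ∑ i, c α i * Y α ω i) μ = gaussianReal 0 v

lemma hasDerivAt_gaussianPDFReal_zero {v : ℝ≥0} (hv : v ≠ 0) (x : ℝ) :
    HasDerivAt (gaussianPDFReal 0 v) (-(x / v) * gaussianPDFReal 0 v x) x := by
  have hv' : (v : ℝ) ≠ 0 := by exact_mod_cast hv
  have h : HasDerivAt (fun y : ℝ => -(y - 0) ^ 2 / (2 * (v : ℝ))) (-(x / v)) x := by
    have := ((((hasDerivAt_id x).sub_const 0).pow 2).neg).div_const (2 * (v : ℝ))
    refine this.congr_deriv ?_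
    simp
    field_simp
  rw [gaussianPDFReal_def]
  refine ((h.exp).const_mul _).congr_deriv ?_
  ring

lemma integrable_pow_mul_gaussianPDFReal {v : ℝ≥0} (hv : v ≠ 0) (m : ℕ) :
    Integrable (fun x => x ^ m * gaussianPDFReal 0 v x) := by
  have hv' : 0 < (v : ℝ) := by exact_mod_cast pos_iff_ne_zero.2 hv
  have h := (integrable_rpow_mul_exp_neg_mul_sq (b := 1 / (2 * (v : ℝ))) (by positivity)
    (s := m) (by linarith [(Nat.cast_nonneg m : (0 : ℝ) ≤ m)])).const_mul
      (Real.sqrt (2 * Real.pi * v))⁻¹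
  refine h.congr (ae_of_all _ fun x => ?_)
  simp only [Real.rpow_natCast, gaussianPDFReal]
  have : -(1 / (2 * (v : ℝ))) * x ^ 2 = -(x - 0) ^ 2 / (2 * v) := by ring
  rw [this]
  ring

/-- The moment recursion of a centered Gaussian law. -/
lemma integral_pow_add_two_gaussianReal (v : ℝ≥0) (m : ℕ) :
    ∫ x, x ^ (m + 2) ∂gaussianReal 0 v = (m + 1) * v * ∫ x, x ^ m ∂gaussianReal 0 v := by
  rcases eq_or_ne v 0 with rfl | hv
  · simp
  have hv' : (v : ℝ) ≠ 0 := by exact_mod_cast hv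
  rw [integral_gaussianReal_eq_integral_smul hv, integral_gaussianReal_eq_integral_smul hv]
  have h := integral_mul_deriv_eq_deriv_mul_of_integrable
    (u := fun x : ℝ => x ^ (m + 1)) (u' := fun x : ℝ => ((m : ℝ) + 1) * x ^ m)
    (v := gaussianPDFReal 0 v) (v' := fun x => -(x / v) * gaussianPDFReal 0 v x)
    (fun x _ => by simpa using hasDerivAt_pow (m + 1) x)
    (fun x _ => hasDerivAt_gaussianPDFReal_zero hv x)
    (((integrable_pow_mul_gaussianPDFReal hv (m + 2)).const_mul (-(v : ℝ)⁻¹)).congr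
      (ae_of_all _ fun x => by simp only [Pi.mul_apply]; ring))
    (((integrable_pow_mul_gaussianPDFReal hv m).const_mul ((m : ℝ) + 1)).congr
      (ae_of_all _ fun x => by simp only [Pi.mul_apply]; ring))
    (integrable_pow_mul_gaussianPDFReal hv (m + 1))
  have e1 : ∀ x : ℝ, x ^ (m + 1) * (-(x / v) * gaussianPDFReal 0 v x) =
      -(v : ℝ)⁻¹ * (gaussianPDFReal 0 v x • x ^ (m + 2)) := fun x => by
    rw [smul_eq_mul]; ring
  have e2 : ∀ x : ℝ, ((m : ℝ) + 1) * x ^ m * gaussianPDFReal 0 v x =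
      (m + 1) * (gaussianPDFReal 0 v x • x ^ m) := fun x => by
    rw [smul_eq_mul]; ring
  simp only [e1, e2, integral_const_mul] at h
  field_simp at h
  linarith

/-- The homogeneous linear polynomial with coefficients `c`. -/
noncomputable def linearForm {ι : Type*} [Fintype ι] (c : ι → ℝ) : MvPolynomial ι ℝ :=
  ∑ i, MvPolynomial.C (c i) * MvPolynomial.X i

section Stein

open MvPolynomial

variable {ι : Type*}

lemma linearForm_add_smul_single [Fintype ι] [DecidableEq ι] (c : ι → ℝ) (a : ι) (t : ℝ) :
    linearForm (c + t • Pi.single a 1) = linearForm c + C t * X a := by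
  simp only [linearForm, Pi.add_apply, map_add, add_mul, Finset.sum_add_distrib]
  congr 1
  rw [Finset.sum_eq_single a] <;> simp +contextual

lemma linearForm_single [Fintype ι] [DecidableEq ι] (a : ι) : linearForm (Pi.single a 1) = X a := by
  simp [linearForm, Pi.single_apply]

lemma hasDerivAt_linearMap_mul_add_pow (Λ : MvPolynomial ι ℝ →ₗ[ℝ] ℝ) (L U : MvPolynomial ι ℝ)
    (m : ℕ) (Z : MvPolynomial ι ℝ) :
    HasDerivAt (fun t : ℝ => Λ (Z * (L + C t * U) ^ m)) (m * Λ (Z * U * L ^ (m - 1))) 0 := by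
  induction m generalizing Z with
  | zero => simpa using hasDerivAt_const (0 : ℝ) (Λ Z)
  | succ m ih =>
    have h : (fun t : ℝ => Λ (Z * (L + C t * U) ^ (m + 1))) = fun t : ℝ =>
        Λ (Z * L * (L + C t * U) ^ m) + t * Λ (Z * U * (L + C t * U) ^ m) := by
      funext t
      rw [← smul_eq_mul (a := t), ← map_smul, ← map_add, smul_eq_C_mul]
      congr 1
      ring
    rw [h]
    refine ((ih (Z * L)).add ((hasDerivAt_id (0 : ℝ)).mul (ih (Z * U)))).congr_deriv ?_
    cases m with
    | zero => simp
    | succ k =>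
      have e : Z * L * U * L ^ k = Z * U * L ^ (k + 1) := by ring
      simp [e]
      ring

/-- A linear functional annihilating all powers of linear forms vanishes. -/
lemma linearMap_eq_zero_of_linearForm_pow [Fintype ι] (Λ : MvPolynomial ι ℝ →ₗ[ℝ] ℝ)
    (h : ∀ c m, Λ (linearForm c ^ m) = 0) (F : MvPolynomial ι ℝ) : Λ F = 0 := by
  classical
  suffices H : ∀ c m, Λ (F * linearForm c ^ m) = 0 by simpa using H 0 0
  induction F using MvPolynomial.induction_on with
  | C r => intro c m; rw [← smul_eq_C_mul, map_smul, h, smul_zero]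
  | add p q hp hq => intro c m; rw [add_mul, map_add, hp, hq, add_zero]
  | mul_X p a hp =>
    intro c m
    have hd := hasDerivAt_linearMap_mul_add_pow Λ (linearForm c) (X a) (m + 1) p
    simp only [← linearForm_add_smul_single, hp] at hd
    have := hd.unique (hasDerivAt_const (0 : ℝ) (0 : ℝ))
    rcases mul_eq_zero.1 this with h0 | h0
    · exact absurd h0 (by positivity)
    · simpa using h0

/-- Moment form of the statement that `E` is the expectation of a centered Gaussian family. -/
structure IsGaussianFunctional [Fintype ι] (E : MvPolynomial ι ℝ →ₗ[ℝ] ℝ) : Prop where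
  map_one : E 1 = 1
  map_linearForm : ∀ c, E (linearForm c) = 0
  map_linearForm_pow : ∀ c (m : ℕ), E (linearForm c ^ (m + 2)) =
    (m + 1) * E (linearForm c ^ 2) * E (linearForm c ^ m)

/-- The derivation `∂ ↦ ∑ b, Cov(a, b) ∂_b`. -/
noncomputable def covDerivation (E : MvPolynomial ι ℝ →ₗ[ℝ] ℝ) (a : ι) :
    Derivation ℝ (MvPolynomial ι ℝ) (MvPolynomial ι ℝ) :=
  mkDerivation ℝ fun b => C (E (X a * X b))

lemma covDerivation_X (E : MvPolynomial ι ℝ →ₗ[ℝ] ℝ) (a b : ι) :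
    covDerivation E a (X b) = C (E (X a * X b)) := mkDerivation_X _ _ _

lemma covDerivation_linearForm [Fintype ι] (E : MvPolynomial ι ℝ →ₗ[ℝ] ℝ) (a : ι) (c : ι → ℝ) :
    covDerivation E a (linearForm c) = C (E (X a * linearForm c)) := by
  simp only [linearForm, map_sum, Finset.mul_sum, ← smul_eq_C_mul, Derivation.map_smul,
    covDerivation_X, map_smul, mul_smul_comm]
  simp [smul_eq_C_mul]

lemma IsGaussianFunctional.map_X_mul_linearForm_pow [Fintype ι]
    {E : MvPolynomial ι ℝ →ₗ[ℝ] ℝ}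
    (hE : IsGaussianFunctional E) (a : ι) (c : ι → ℝ) (m : ℕ) :
    E (X a * linearForm c ^ m) = m * E (X a * linearForm c) * E (linearForm c ^ (m - 1)) := by
  classical
  induction m using Nat.strong_induction_on with
  | _ m ih =>
  rcases m with _ | k
  · simpa [linearForm_single] using hE.map_linearForm (Pi.single a 1)
  have hd := fun j => hasDerivAt_linearMap_mul_add_pow E (linearForm c) (X a) j 1
  simp only [one_mul] at hd
  have h1 := hd (k + 2)
  have h2 := ((hd 2).mul (hd k)).const_mul ((k : ℝ) + 1)
  have hfun : (fun t : ℝ => E ((linearForm c + C t * X a) ^ (k + 2))) = fun t : ℝ =>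
      ((k : ℝ) + 1) * (E ((linearForm c + C t * X a) ^ 2) * E ((linearForm c + C t * X a) ^ k)) := by
    funext t
    rw [← linearForm_add_smul_single, hE.map_linearForm_pow, mul_assoc]
  rw [hfun] at h1
  have h := h1.unique h2
  have key : (k : ℝ) * E (linearForm c ^ 2) * E (X a * linearForm c ^ (k - 1)) =
      k * E (X a * linearForm c) * E (linearForm c ^ k) := by
    rcases k with _ | _ | k
    · simp
    · simp only [zero_add, Nat.sub_self, pow_zero, pow_one, hE.map_linearForm, mul_zero]
      have := hE.map_linearForm (Pi.single a 1)
      rw [linearForm_single] at this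
      simp [this]
    · have h1 := ih (k + 1) (by omega)
      have h2 := hE.map_linearForm_pow c k
      simp only [Nat.add_sub_cancel] at h1 ⊢
      rw [show k + 1 + 1 = k + 2 from rfl, h2, h1]
      push_cast
      ring
  have hk : ((k : ℝ) + 2) ≠ 0 := by positivity
  simp only [map_zero, zero_mul, add_zero, Nat.add_sub_cancel, pow_one,
    show k + 2 - 1 = k + 1 from rfl, show 2 - 1 = 1 from rfl] at h ⊢
  push_cast at h ⊢
  apply mul_left_cancel₀ hk
  linear_combination h + ((k : ℝ) + 1) * key

/-- Gaussian integration by parts for polynomials. -/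
lemma IsGaussianFunctional.map_X_mul [Fintype ι] {E : MvPolynomial ι ℝ →ₗ[ℝ] ℝ}
    (hE : IsGaussianFunctional E) (a : ι) (F : MvPolynomial ι ℝ) :
    E (X a * F) = E (covDerivation E a F) := by
  have := linearMap_eq_zero_of_linearForm_pow
    (E ∘ₗ LinearMap.mulLeft ℝ (X a) - E ∘ₗ (covDerivation E a : MvPolynomial ι ℝ →ₗ[ℝ] _)) ?_ F
  · simpa [sub_eq_zero] using this
  intro c m
  simp only [LinearMap.sub_apply, LinearMap.comp_apply, LinearMap.mulLeft_apply,
    Derivation.coeFn_coe, sub_eq_zero, hE.map_X_mul_linearForm_pow, Derivation.leibniz_pow,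
    covDerivation_linearForm]
  rw [smul_eq_mul, mul_comm (_ ^ _), ← smul_eq_C_mul, map_nsmul, map_smul, nsmul_eq_mul,
    smul_eq_mul, mul_assoc]

/-- Chain rule for a derivation along a renaming of variables. -/
lemma derivation_rename {κ : Type*} [Fintype κ] (f : κ → ι)
    (D : Derivation ℝ (MvPolynomial ι ℝ) (MvPolynomial ι ℝ)) (p : MvPolynomial κ ℝ) :
    D (rename f p) = ∑ j, rename f (pderiv j p) * D (X (f j)) := by
  classical
  induction p using MvPolynomial.induction_on with
  | C r => simp
  | add p q hp hq => simp [hp, hq, add_mul, Finset.sum_add_distrib]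
  | mul_X p i hp =>
    simp only [map_mul, rename_X, Derivation.leibniz, hp, pderiv_X, smul_eq_mul, map_add, add_mul,
      Finset.sum_add_distrib, Finset.mul_sum]
    congr 1
    · rw [Finset.sum_eq_single i] <;> simp +contextual
    · exact Finset.sum_congr rfl fun j _ => by ring

/-- Each `p` with `∑ i, (X i ∂_i p - ∂_i² p) = n p` satisfies the polarized energy identity. -/
lemma IsGaussianFunctional.natCast_mul_map_mul [Fintype ι] {E : MvPolynomial ι ℝ →ₗ[ℝ] ℝ}
    (hE : IsGaussianFunctional E) {κ κ' : Type*} [Fintype κ] [DecidableEq κ] [Fintype κ']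
    (f : κ → ι) (g : κ' → ι)
    (hf : ∀ i j, E (X (f i) * X (f j)) = if i = j then 1 else 0) (n : ℕ)
    {p : MvPolynomial κ ℝ} (hp : ∑ i, (X i * pderiv i p - pderiv i (pderiv i p)) = n * p)
    (q : MvPolynomial κ' ℝ) :
    n * E (rename f p * rename g q) = ∑ i, ∑ j, E (X (f i) * X (g j)) *
      E (rename f (pderiv i p) * rename g (pderiv j q)) := by
  have h : (n : MvPolynomial ι ℝ) * rename f p =
      ∑ i, (X (f i) * rename f (pderiv i p) - rename f (pderiv i (pderiv i p))) := by
    simpa using (congrArg (rename f) hp).symm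
  rw [← nsmul_eq_mul, ← map_nsmul, nsmul_eq_mul, ← mul_assoc, h, Finset.sum_mul, map_sum]
  refine Finset.sum_congr rfl fun i _ => ?_
  rw [sub_mul, map_sub, mul_assoc, hE.map_X_mul, Derivation.leibniz, derivation_rename f,
    derivation_rename g]
  simp only [covDerivation_X, hf, smul_eq_mul, map_add]
  have : ∑ j, rename f (pderiv j (pderiv i p)) * C (if i = j then (1 : ℝ) else 0) =
      rename f (pderiv i (pderiv i p)) := by
    rw [Finset.sum_eq_single i] <;> simp +contextual [eq_comm]
  rw [this, mul_comm (rename g q), add_sub_cancel_right, Finset.mul_sum, map_sum]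
  refine Finset.sum_congr rfl fun j _ => ?_
  rw [← mul_assoc, mul_comm _ (C _), ← smul_eq_C_mul, map_smul, smul_eq_mul]

end Stein

section Hermite

open scoped Polynomial

lemma derivative_hermite_succ (n : ℕ) :
    Polynomial.derivative (Polynomial.hermite (n + 1)) = ((n : ℤ[X]) + 1) * Polynomial.hermite n := by
  induction n with
  | zero => simp
  | succ n ih =>
    rw [Polynomial.hermite_succ (n + 1), Polynomial.derivative_sub, Polynomial.derivative_mul, ih]
    have h := Polynomial.hermite_succ n
    have : Polynomial.derivative (((n : ℤ[X]) + 1) * Polynomial.hermite n) =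
      ((n : ℤ[X]) + 1) * Polynomial.derivative (Polynomial.hermite n) := by simp
    rw [this, Polynomial.derivative_X]
    push_cast
    linear_combination -((n : ℤ[X]) + 1) * h

lemma X_mul_derivative_hermite_sub (n : ℕ) :
    Polynomial.X * Polynomial.derivative (Polynomial.hermite n) -
      Polynomial.derivative (Polynomial.derivative (Polynomial.hermite n)) =
        (n : ℤ[X]) * Polynomial.hermite n := by
  have h := derivative_hermite_succ n
  rw [Polynomial.hermite_succ, Polynomial.derivative_sub, Polynomial.derivative_mul,
    Polynomial.derivative_X] at h
  linear_combination h

open MvPolynomial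

variable {κ : Type*}

/-- The multidimensional Hermite polynomial with multi-index `k`. -/
noncomputable def mvHermite [Fintype κ] (k : κ → ℕ) : MvPolynomial κ ℝ :=
  ∏ i, Polynomial.aeval (X i) (Polynomial.hermite (k i))

lemma pderiv_aeval_X [DecidableEq κ] (i j : κ) (P : Polynomial ℤ) :
    pderiv i (Polynomial.aeval (X j : MvPolynomial κ ℝ) P) =
      if i = j then Polynomial.aeval (X j) (Polynomial.derivative P) else 0 := by
  have := ((pderiv (R := ℝ) i).restrictScalars ℤ).map_aeval P (X j)
  rw [Derivation.restrictScalars_apply, Derivation.restrictScalars_apply, pderiv_X] at this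
  rw [this]
  by_cases h : i = j <;> simp [h, eq_comm]

lemma sum_number_mvHermite [Fintype κ] (k : κ → ℕ) :
    ∑ i, (X i * pderiv i (mvHermite k) - pderiv i (pderiv i (mvHermite k))) =
      ((∑ i, k i : ℕ) : MvPolynomial κ ℝ) * mvHermite k := by
  classical
  rw [Nat.cast_sum, Finset.sum_mul]
  refine Finset.sum_congr rfl fun i _ => ?_
  let r : MvPolynomial κ ℝ :=
    ∏ j ∈ Finset.univ.erase i, Polynomial.aeval (X j) (Polynomial.hermite (k j))
  have hfac : mvHermite k = Polynomial.aeval (X i) (Polynomial.hermite (k i)) * r :=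
    (Finset.mul_prod_erase _ _ (Finset.mem_univ i)).symm
  have hr0 : pderiv i r = 0 := by
    refine Finset.prod_induction _ (fun x => pderiv i x = 0) (fun x y hx hy => ?_) (by simp)
      fun j hj => ?_
    · rw [pderiv_mul, hx, hy, zero_mul, mul_zero, add_zero]
    · rw [pderiv_aeval_X, if_neg (Finset.ne_of_mem_erase hj).symm]
  have h := congrArg (Polynomial.aeval (X i : MvPolynomial κ ℝ))
    (X_mul_derivative_hermite_sub (k i))
  simp only [map_sub, map_mul, Polynomial.aeval_X, map_natCast] at h
  simp only [hfac, pderiv_mul, hr0, pderiv_aeval_X, if_true, mul_zero, add_zero]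
  linear_combination r * h

end Hermite

section Expectation

open MvPolynomial

variable {Ω ι : Type*} [MeasurableSpace Ω] {μ : Measure Ω} {G : Ω → ι → ℝ}

lemma memLp_of_map_eq_gaussianReal {X : Ω → ℝ} {v : ℝ≥0} (h : μ.map X = gaussianReal 0 v)
    (p : ℝ≥0) : MemLp X p μ := by
  have hX : AEMeasurable X μ := by
    by_contra hX
    rw [Measure.map_of_not_aemeasurable hX] at h
    exact IsProbabilityMeasure.ne_zero (gaussianReal 0 v) h.symm
  have := memLp_id_gaussianReal (μ := 0) (v := v) p
  rw [← h] at this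
  exact this.comp_of_map hX

lemma memLp_eval [IsFiniteMeasure μ] (hG : ∀ i, ∀ p : ℝ≥0, MemLp (fun ω => G ω i) p μ)
    (F : MvPolynomial ι ℝ) (p : ℝ≥0) : MemLp (fun ω => eval (G ω) F) p μ := by
  induction F using MvPolynomial.induction_on generalizing p with
  | C r => simpa using memLp_const r
  | add F₁ F₂ h₁ h₂ => simpa using! (h₁ p).add (h₂ p)
  | mul_X F i hF =>
    have : ENNReal.HolderTriple ((2 * p : ℝ≥0) : ENNReal) ((2 * p : ℝ≥0) : ENNReal) p := by
      constructor
      rcases eq_or_ne p 0 with rfl | hp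
      · simp
      · rw [← ENNReal.coe_inv (by positivity), ← ENNReal.coe_inv hp, ← ENNReal.coe_add]
        congr 1
        field_simp
        norm_num
    simpa using (hG i (2 * p)).mul' (hF (2 * p))

/-- The expectation of polynomials in the random vector `G`. -/
noncomputable def polynomialExpectation (hint : ∀ F, Integrable (fun ω => eval (G ω) F) μ) :
    MvPolynomial ι ℝ →ₗ[ℝ] ℝ where
  toFun F := ∫ ω, eval (G ω) F ∂μ
  map_add' F₁ F₂ := by simpa using integral_add (hint F₁) (hint F₂)
  map_smul' r F := by simp [integral_const_mul]

lemma isGaussianFunctional_polynomialExpectation [Fintype ι] [IsProbabilityMeasure μ]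
    (hG : ∀ c : ι → ℝ, ∃ v : ℝ≥0, μ.map (fun ω => ∑ i, c i * G ω i) = gaussianReal 0 v)
    (hint : ∀ F, Integrable (fun ω => eval (G ω) F) μ) :
    IsGaussianFunctional (polynomialExpectation hint) := by
  have hpow : ∀ c, ∃ v : ℝ≥0, ∀ m, polynomialExpectation hint (linearForm c ^ m) =
      ∫ x, x ^ m ∂gaussianReal 0 v := by
    intro c
    obtain ⟨v, hv⟩ := hG c
    refine ⟨v, fun m => ?_⟩
    have hm := (memLp_of_map_eq_gaussianReal hv 1).aestronglyMeasurable.aemeasurable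
    rw [← hv, integral_map hm (by fun_prop)]
    simp [polynomialExpectation, linearForm]
  refine ⟨by simp [polynomialExpectation], fun c => ?_, fun c m => ?_⟩
  · obtain ⟨v, hv⟩ := hpow c
    simpa [integral_id_gaussianReal] using hv 1
  · obtain ⟨v, hv⟩ := hpow c
    have h2 := integral_pow_add_two_gaussianReal v 0
    simp only [hv, integral_pow_add_two_gaussianReal v m]
    simp at h2
    simp [h2]

end Expectation

section LinearAlgebra

open Matrix

/-- A real symmetric matrix whose eigenvalues are at most `t` has Rayleigh quotient at most `t`. -/
lemma dotProduct_mulVec_le_of_eigenvalues_le {κ : Type*} [Fintype κ] {A : Matrix κ κ ℝ}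
    (hA : A.transpose = A) {t : ℝ} (ht : ∀ (r : ℝ) (v : κ → ℝ), v ≠ 0 → A *ᵥ v = r • v → r ≤ t)
    (y : κ → ℝ) : y ⬝ᵥ (A *ᵥ y) ≤ t * (y ⬝ᵥ y) := by
  classical
  have hB : (t • (1 : Matrix κ κ ℝ) - A).IsHermitian := by
    rw [Matrix.IsHermitian, conjTranspose_eq_transpose_of_trivial]
    simp [hA]
  have hpos : (t • (1 : Matrix κ κ ℝ) - A).PosSemidef := by
    rw [hB.posSemidef_iff_eigenvalues_nonneg]
    intro j
    have h := hB.mulVec_eigenvectorBasis j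
    have hne : (hB.eigenvectorBasis j).ofLp ≠ 0 := by
      intro h0
      apply hB.eigenvectorBasis.toBasis.ne_zero j
      rw [OrthonormalBasis.coe_toBasis]
      ext i
      exact congrFun h0 i
    have h' := ht (t - hB.eigenvalues j) _ hne (by
      rw [sub_mulVec, smul_mulVec, one_mulVec] at h
      rw [sub_smul, ← h, sub_sub_cancel])
    simpa using h'
  have := hpos.dotProduct_mulVec_nonneg y
  rw [sub_mulVec, smul_mulVec, one_mulVec, dotProduct_sub, dotProduct_smul] at this
  simpa using this

lemma abs_dotProduct_mulVec_le {κ κ' : Type*} [Fintype κ] [Fintype κ'] {A : Matrix κ κ' ℝ} {s : ℝ}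
    (hs : 0 ≤ s) (ht : ∀ (r : ℝ) (v : κ' → ℝ), v ≠ 0 → (A.transpose * A) *ᵥ v = r • v → r ≤ s ^ 2)
    (x : κ → ℝ) (y : κ' → ℝ) :
    |x ⬝ᵥ (A *ᵥ y)| ≤ √(x ⬝ᵥ x) * (s * √(y ⬝ᵥ y)) := by
  have h := dotProduct_mulVec_le_of_eigenvalues_le (A := A.transpose * A) (by simp) ht y
  rw [← mulVec_mulVec, dotProduct_mulVec, vecMul_transpose] at h
  have hcs : (x ⬝ᵥ (A *ᵥ y)) ^ 2 ≤ (x ⬝ᵥ x) * ((A *ᵥ y) ⬝ᵥ (A *ᵥ y)) := by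
    simpa [dotProduct, sq] using Finset.sum_mul_sq_le_sq_mul_sq Finset.univ x (A *ᵥ y)
  have hx : 0 ≤ x ⬝ᵥ x := Finset.sum_nonneg fun i _ => mul_self_nonneg (x i)
  have hy : 0 ≤ y ⬝ᵥ y := Finset.sum_nonneg fun i _ => mul_self_nonneg (y i)
  refine abs_le_of_sq_le_sq ?_ (by positivity)
  rw [mul_pow, mul_pow, Real.sq_sqrt hx, Real.sq_sqrt hy]
  exact hcs.trans (by gcongr)

/-- The largest singular value is bounded by that of the transpose. -/
lemma singularValue_le_transpose {κ κ' : Type*} [Fintype κ] [Fintype κ'] {A : Matrix κ κ' ℝ}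
    {s s' : ℝ} (hs' : 0 ≤ s')
    (hEig : ∃ v : κ' → ℝ, v ≠ 0 ∧ (A.transpose * A) *ᵥ v = s ^ 2 • v)
    (hMax : ∀ (r : ℝ) (v : κ → ℝ), v ≠ 0 → (A * A.transpose) *ᵥ v = r • v → r ≤ s' ^ 2) :
    s ≤ s' := by
  obtain ⟨v, hv0, hv⟩ := hEig
  rcases eq_or_ne s 0 with rfl | hs
  · exact hs'
  refine le_of_sq_le_sq (hMax _ (A *ᵥ v) (fun h0 => ?_) ?_) hs'
  · rw [← mulVec_mulVec, h0, mulVec_zero] at hv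
    exact (smul_ne_zero (pow_ne_zero 2 hs) hv0) hv.symm
  · rw [mulVec_mulVec, Matrix.mul_assoc, ← mulVec_mulVec, hv, mulVec_smul]

/-- A block off-diagonal quadratic form is controlled by the largest eigenvalue of the matrix of
largest singular values of its blocks. -/
lemma abs_sum_block_le {κ : Type*} [Fintype κ] [DecidableEq κ] {ι : κ → Type*}
    [∀ α, Fintype (ι α)]
    (R : (α β : κ) → Matrix (ι α) (ι β) ℝ)
    (hsymm : ∀ α β, α ≠ β → R β α = (R α β).transpose) (s : κ → κ → ℝ)
    (hsdiag : ∀ α, s α α = 0)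
    (hs0 : ∀ α β, α ≠ β → 0 ≤ s α β)
    (hsEig : ∀ α β, α ≠ β → ∃ v : ι β → ℝ, v ≠ 0 ∧
      ((R α β).transpose * R α β).mulVec v = (s α β) ^ 2 • v)
    (hsMax : ∀ α β, α ≠ β → ∀ (t : ℝ) (v : ι β → ℝ), v ≠ 0 →
      ((R α β).transpose * R α β).mulVec v = t • v → t ≤ (s α β) ^ 2)
    (σ : ℝ) (hσMax : ∀ (t : ℝ) (v : κ → ℝ), v ≠ 0 → (Matrix.of s).mulVec v = t • v → t ≤ σ)
    (w : (α : κ) → ι α → ℝ) :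
    |∑ α, ∑ β, if α = β then 0 else w α ⬝ᵥ (R α β *ᵥ w β)| ≤ σ * ∑ α, w α ⬝ᵥ w α := by
  have hle : ∀ α β, α ≠ β → s α β ≤ s β α := fun α β h =>
    singularValue_le_transpose (hs0 β α h.symm) (hsEig α β h) (by
      have := hsMax β α h.symm
      rwa [hsymm α β h, transpose_transpose] at this)
  have hS : (Matrix.of s).transpose = Matrix.of s := by
    ext α β
    rcases eq_or_ne α β with rfl | h
    · rfl
    · exact le_antisymm (hle β α h.symm) (hle α β h)
  have hray := dotProduct_mulVec_le_of_eigenvalues_le hS hσMax fun α => √(w α ⬝ᵥ w α)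
  have hnorm : (fun α => √(w α ⬝ᵥ w α)) ⬝ᵥ (fun α => √(w α ⬝ᵥ w α)) = ∑ α, w α ⬝ᵥ w α :=
    Finset.sum_congr rfl fun α _ => 
      Real.mul_self_sqrt (Finset.sum_nonneg fun i _ => mul_self_nonneg (w α i))
  rw [hnorm] at hray
  refine le_trans ?_ hray
  refine (Finset.abs_sum_le_sum_abs _ _).trans (Finset.sum_le_sum fun α _ => ?_)
  rw [mulVec, dotProduct, Finset.mul_sum]
  refine (Finset.abs_sum_le_sum_abs _ _).trans (Finset.sum_le_sum fun β _ => ?_)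
  split_ifs with h
  · simp [← h, hsdiag]
  · exact abs_dotProduct_mulVec_le (hs0 α β h) (hsMax α β h) _ _

end LinearAlgebra

/-- **Decoupling for degree-`n` Wick polynomials of N Gaussian vectors.** With `σ₀` the largest
eigenvalue of the matrix of largest singular values of the cross-correlation matrices, the
degree-`n` Wick polynomials `Pₙ(Y α)` satisfy
`|‖∑ Pₙ(Y α)‖₂² − ∑ ‖Pₙ(Y α)‖₂²| ≤ σ₀ ∑ ‖Pₙ(Y α)‖₂²`, hence
`(1 − σ₀) ∑ ‖Pₙ(Y α)‖₂² ≤ ‖∑ Pₙ(Y α)‖₂² ≤ (1 + σ₀) ∑ ‖Pₙ(Y α)‖₂²`. -/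
theorem wick_degree_n_decoupling_N_vectors
    {Ω : Type*} [MeasurableSpace Ω] (μ : Measure Ω) [IsProbabilityMeasure μ]
    {N : ℕ} {d : Fin N → ℕ} (Y : (α : Fin N) → Ω → Fin (d α) → ℝ)
    (hGauss : IsJointGaussianFamily μ Y)
    (hmean : ∀ α i, ∫ ω, Y α ω i ∂μ = 0)
    (hcov : ∀ α i j, ∫ ω, Y α ω i * Y α ω j ∂μ = if i = j then 1 else 0)
    (R : (α β : Fin N) → Matrix (Fin (d α)) (Fin (d β)) ℝ)
    (hR : ∀ α β, α ≠ β → ∀ i j, R α β i j = ∫ ω, Y α ω i * Y β ω j ∂μ)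
    (s : Fin N → Fin N → ℝ)
    (hsdiag : ∀ α, s α α = 0)
    (hs0 : ∀ α β, α ≠ β → 0 ≤ s α β)
    (hsEig : ∀ α β, α ≠ β → ∃ v : Fin (d β) → ℝ, v ≠ 0 ∧
      ((R α β).transpose * R α β).mulVec v = (s α β) ^ 2 • v)
    (hsMax : ∀ α β, α ≠ β → ∀ (t : ℝ) (v : Fin (d β) → ℝ), v ≠ 0 →
      ((R α β).transpose * R α β).mulVec v = t • v → t ≤ (s α β) ^ 2)
    (σ₀ : ℝ)
    (hσEig : ∃ v : Fin N → ℝ, v ≠ 0 ∧ (Matrix.of s).mulVec v = σ₀ • v)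
    (hσMax : ∀ (t : ℝ) (v : Fin N → ℝ), v ≠ 0 → (Matrix.of s).mulVec v = t • v → t ≤ σ₀)
    (n : ℕ) (hn : 1 ≤ n)
    (K : (α : Fin N) → Finset (Fin (d α) → ℕ))
    (hK : ∀ α, ∀ k ∈ K α, ∑ i, k i = n)
    (a : (α : Fin N) → (Fin (d α) → ℕ) → ℝ)
    (P : Fin N → Ω → ℝ)
    (hP : ∀ α, P α = fun ω => ∑ k ∈ K α, a α k *
      ((∏ i, He (k i) (Y α ω i)) / Real.sqrt (∏ i, (Nat.factorial (k i) : ℝ)))) :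
    |(∫ ω, (∑ α, P α ω) ^ 2 ∂μ) - ∑ α, ∫ ω, (P α ω) ^ 2 ∂μ| ≤
        σ₀ * ∑ α, ∫ ω, (P α ω) ^ 2 ∂μ ∧
      (1 - σ₀) * ∑ α, ∫ ω, (P α ω) ^ 2 ∂μ ≤ ∫ ω, (∑ α, P α ω) ^ 2 ∂μ ∧
      ∫ ω, (∑ α, P α ω) ^ 2 ∂μ ≤ (1 + σ₀) * ∑ α, ∫ ω, (P α ω) ^ 2 ∂μ := by
  let G : Ω → (Σ α, Fin (d α)) → ℝ := fun ω b => Y b.1 ω b.2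
  have hG : ∀ c : (Σ α, Fin (d α)) → ℝ, ∃ v : ℝ≥0, μ.map (fun ω => ∑ b, c b * G ω b) =
      gaussianReal 0 v := by
    intro c
    simpa only [Fintype.sum_sigma] using hGauss fun α i => c ⟨α, i⟩
  have hmem : ∀ b, ∀ p : ℝ≥0, MemLp (fun ω => G ω b) p μ := by
    classical
    intro b p
    obtain ⟨v, hv⟩ := hG (Pi.single b 1)
    simpa [Pi.single_apply] using memLp_of_map_eq_gaussianReal hv p
  have hint : ∀ F, Integrable (fun ω => MvPolynomial.eval (G ω) F) μ := fun F =>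
    memLp_one_iff_integrable.1 (memLp_eval hmem F 1)
  let E := polynomialExpectation hint
  have hEdef : ∀ F, E F = ∫ ω, MvPolynomial.eval (G ω) F ∂μ := fun F => rfl
  have hE : IsGaussianFunctional E := isGaussianFunctional_polynomialExpectation hG hint
  let f : (α : Fin N) → Fin (d α) → Σ α, Fin (d α) := fun α i => ⟨α, i⟩
  have hcross : ∀ α β i j, E (MvPolynomial.X (f α i) * MvPolynomial.X (f β j)) =
      ∫ ω, Y α ω i * Y β ω j ∂μ := by
    intro α β i j
    simp [hEdef, G, f]
  have hdiag : ∀ α i j, E (MvPolynomial.X (f α i) * MvPolynomial.X (f α j)) =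
      if i = j then 1 else 0 := by
    intro α i j
    rw [hcross, hcov]
  let p : (α : Fin N) → MvPolynomial (Fin (d α)) ℝ := fun α => ∑ k ∈ K α,
    MvPolynomial.C (a α k / Real.sqrt (∏ i, (Nat.factorial (k i) : ℝ))) * mvHermite k
  have hPeval : ∀ α ω, P α ω = MvPolynomial.eval (G ω) (MvPolynomial.rename (f α) (p α)) := by
    intro α ω
    have hHe : ∀ (m : ℕ) (i : Fin (d α)), MvPolynomial.eval (G ω ∘ f α)
        (Polynomial.aeval (MvPolynomial.X i : MvPolynomial (Fin (d α)) ℝ) (Polynomial.hermite m)) =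
          He m (Y α ω i) := by
      intro m i
      have := Polynomial.aeval_algHom_apply (((MvPolynomial.aeval (G ω ∘ f α)).restrictScalars ℤ :
        MvPolynomial (Fin (d α)) ℝ →ₐ[ℤ] ℝ)) (MvPolynomial.X i) (Polynomial.hermite m)
      simpa [He, G, f] using! this.symm
    simp only [hP, p, MvPolynomial.eval_rename, map_sum, map_mul, MvPolynomial.eval_C, mvHermite,
      map_prod, hHe]
    exact Finset.sum_congr rfl fun k _ => by ring
  have hnum : ∀ α, ∑ i, (MvPolynomial.X i * MvPolynomial.pderiv i (p α) -
      MvPolynomial.pderiv i (MvPolynomial.pderiv i (p α))) = n * p α := by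
    intro α
    have : ∀ i, MvPolynomial.X i * MvPolynomial.pderiv i (p α) -
        MvPolynomial.pderiv i (MvPolynomial.pderiv i (p α)) = ∑ k ∈ K α,
        MvPolynomial.C (a α k / Real.sqrt (∏ i, (Nat.factorial (k i) : ℝ))) *
          (MvPolynomial.X i * MvPolynomial.pderiv i (mvHermite k) -
            MvPolynomial.pderiv i (MvPolynomial.pderiv i (mvHermite k))) := by
      intro i
      simp only [p, map_sum, MvPolynomial.pderiv_C_mul, Finset.mul_sum, ← Finset.sum_sub_distrib]
      exact Finset.sum_congr rfl fun k _ => by ring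
    simp only [this]
    rw [Finset.sum_comm, Finset.mul_sum]
    refine Finset.sum_congr rfl fun k hk => ?_
    rw [← Finset.mul_sum, sum_number_mvHermite, hK α k hk]
    ring
  let w : Ω → (α : Fin N) → Fin (d α) → ℝ :=
    fun ω α i => MvPolynomial.eval (G ω) (MvPolynomial.rename (f α) (MvPolynomial.pderiv i (p α)))
  have hwint : ∀ α β i j, Integrable (fun ω => w ω α i * w ω β j) μ := by
    intro α β i j
    simpa [w] using hint (MvPolynomial.rename (f α) (MvPolynomial.pderiv i (p α)) *
      MvPolynomial.rename (f β) (MvPolynomial.pderiv j (p β)))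
  have hprod : ∀ α β, ∫ ω, P α ω * P β ω ∂μ =
      E (MvPolynomial.rename (f α) (p α) * MvPolynomial.rename (f β) (p β)) := by
    intro α β
    simp only [hEdef, hPeval, map_mul]
  have hPint : ∀ α β, Integrable (fun ω => P α ω * P β ω) μ := by
    intro α β
    simpa [hPeval] using hint (MvPolynomial.rename (f α) (p α) * MvPolynomial.rename (f β) (p β))
  have henergy : ∀ α β, n * ∫ ω, P α ω * P β ω ∂μ =
      ∑ i, ∑ j, (∫ ω, Y α ω i * Y β ω j ∂μ) * ∫ ω, w ω α i * w ω β j ∂μ := by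
    intro α β
    rw [hprod, hE.natCast_mul_map_mul (f α) (f β) (hdiag α) n (hnum α)]
    simp only [hcross, hEdef, map_mul, w]
  have hsq : n * ∑ α, ∫ ω, (P α ω) ^ 2 ∂μ = ∫ ω, ∑ α, w ω α ⬝ᵥ w ω α ∂μ := by
    simp only [dotProduct]
    rw [integral_finsetSum _ fun α _ => integrable_finsetSum _ fun i _ => hwint α α i i,
      Finset.mul_sum]
    refine Finset.sum_congr rfl fun α _ => ?_
    rw [integral_finsetSum _ fun i _ => hwint α α i i]
    simp only [sq, henergy, hcov, ite_mul, one_mul, zero_mul, Finset.sum_ite_eq,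
      Finset.mem_univ, if_true]
  have hoff : n * ((∫ ω, (∑ α, P α ω) ^ 2 ∂μ) - ∑ α, ∫ ω, (P α ω) ^ 2 ∂μ) =
      ∫ ω, ∑ α, ∑ β, (if α = β then 0 else w ω α ⬝ᵥ (R α β).mulVec (w ω β)) ∂μ := by
    have hexp : ∫ ω, (∑ α, P α ω) ^ 2 ∂μ = ∑ α, ∑ β, ∫ ω, P α ω * P β ω ∂μ := by
      simp only [sq, Finset.sum_mul_sum]
      rw [integral_finsetSum _ fun α _ => integrable_finsetSum _ fun β _ => hPint α β]
      exact Finset.sum_congr rfl fun α _ => integral_finsetSum _ fun β _ => hPint α β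
    have hterm : ∀ α β, (fun ω => if α = β then 0 else w ω α ⬝ᵥ (R α β).mulVec (w ω β)) =
        fun ω => ∑ i, ∑ j, (if α = β then 0 else R α β i j) * (w ω α i * w ω β j) := by
      intro α β
      funext ω
      split_ifs
      · simp
      · simp only [dotProduct, Matrix.mulVec, Finset.mul_sum]
        exact Finset.sum_congr rfl fun i _ => Finset.sum_congr rfl fun j _ => by ring
    have hint₁ : ∀ α β i, Integrable (fun ω => ∑ j, (if α = β then 0 else R α β i j) *
        (w ω α i * w ω β j)) μ := fun α β i =>
      integrable_finsetSum _ fun j _ => (hwint α β i j).const_mul _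
    have hint₂ : ∀ α β, Integrable
        (fun ω => if α = β then 0 else w ω α ⬝ᵥ (R α β).mulVec (w ω β)) μ := by
      intro α β
      rw [hterm]
      exact integrable_finsetSum _ fun i _ => hint₁ α β i
    rw [hexp, ← Finset.sum_sub_distrib, Finset.mul_sum,
      integral_finsetSum _ fun α _ => integrable_finsetSum _ fun β _ => hint₂ α β]
    refine Finset.sum_congr rfl fun α _ => ?_
    rw [integral_finsetSum _ fun β _ => hint₂ α β]
    have hsplit : ∑ β, ∫ ω, P α ω * P β ω ∂μ - ∫ ω, (P α ω) ^ 2 ∂μ =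
        ∑ β, if α = β then 0 else ∫ ω, P α ω * P β ω ∂μ := by
      rw [sub_eq_iff_eq_add, ← Finset.sum_erase_add _ _ (Finset.mem_univ α),
        ← Finset.sum_erase_add (a := α) Finset.univ _ (Finset.mem_univ α)]
      simp only [sq, if_true, add_zero]
      congr 1
      exact Finset.sum_congr rfl fun β hβ => by rw [if_neg (Finset.ne_of_mem_erase hβ).symm]
    rw [hsplit, Finset.mul_sum]
    refine Finset.sum_congr rfl fun β _ => ?_
    rw [hterm, integral_finsetSum _ fun i _ => hint₁ α β i]
    split_ifs with h
    · simp
    · rw [henergy]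
      refine Finset.sum_congr rfl fun i _ => ?_
      rw [integral_finsetSum _ fun j _ => (hwint α β i j).const_mul _]
      exact Finset.sum_congr rfl fun j _ => by rw [integral_const_mul, hR α β h]
  have hRsymm : ∀ α β, α ≠ β → R β α = (R α β).transpose := by
    intro α β h
    ext i j
    rw [Matrix.transpose_apply, hR α β h, hR β α h.symm]
    simp only [mul_comm]
  have hmain : |(∫ ω, (∑ α, P α ω) ^ 2 ∂μ) - ∑ α, ∫ ω, (P α ω) ^ 2 ∂μ| ≤
      σ₀ * ∑ α, ∫ ω, (P α ω) ^ 2 ∂μ := by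
    have hn' : (0 : ℝ) < n := by exact_mod_cast hn
    refine le_of_mul_le_mul_left ?_ hn'
    rw [mul_left_comm, hsq, ← abs_of_pos hn', ← abs_mul, hoff, ← integral_const_mul]
    refine abs_integral_le_integral_abs.trans (integral_mono_of_nonneg
      (ae_of_all _ fun ω => abs_nonneg _) ?_ (ae_of_all _ fun ω => ?_))
    · simp only [dotProduct]
      exact (integrable_finsetSum _ fun α _ =>
        integrable_finsetSum _ fun i _ => hwint α α i i).const_mul _
    · exact abs_sum_block_le R hRsymm s hsdiag hs0 hsEig hsMax σ₀ hσMax (w ω)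
  refine ⟨hmain, ?_, ?_⟩
  · linarith [(abs_le.1 hmain).1]
  · linarith [(abs_le.1 hmain).2]
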